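/- arXiv:2102.04957 — 3 statements merged into one kernel-verified Lean document; each statement's English description precedes it below -/
import Mathlib

section
/- For every even n = 2r with r ≥ 2, the orientation of K_{r,r} in which a perfect matching is directed from X to Y and all other edges are directed from Y to X is a strongly connected 2-geodetic digraph with r² arcs. -/
/-- A directed walk in a digraph with arc relation `A`, encoded as a nonempty list of
consecutive vertices; its length is `p.length - 1`. -/
def IsWalk {V : Type*} (A : V → V → Prop) (p : List V) : Prop :=
  p ≠ [] ∧ p.Chain' A

/-- A digraph is `k`-geodetic if for every ordered pair of (not necessarily distinct)
vertices there is at most one directed walk between them of length at most `k`. -/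
def IsKGeodetic {V : Type*} (A : V → V → Prop) (k : ℕ) : Prop :=
  ∀ p q : List V, IsWalk A p → IsWalk A q → p.head? = q.head? →
    p.getLast? = q.getLast? → p.length ≤ k + 1 → q.length ≤ k + 1 → p = q

/-- The number of arcs (the size) of a digraph. -/
noncomputable def numArcs {V : Type*} (A : V → V → Prop) : ℕ :=
  Nat.card {p : V × V // A p.1 p.2}

/-- The out-degree of a vertex. -/
noncomputable def outDeg {V : Type*} (A : V → V → Prop) (v : V) : ℕ :=
  Nat.card {w : V // A v w}

/-- The in-degree of a vertex. -/
noncomputable def inDeg {V : Type*} (A : V → V → Prop) (v : V) : ℕ :=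
  Nat.card {w : V // A w v}

/-- `exGeo n k` is the maximum number of arcs of a `k`-geodetic digraph on `n` vertices. -/
noncomputable def exGeo (n k : ℕ) : ℕ :=
  sSup {m | ∃ A : Fin n → Fin n → Prop, IsKGeodetic A k ∧ numArcs A = m}

/-- An orientation of the complete bipartite graph `K_{s,t}` with partite sets
`Fin s` and `Fin t`: between any vertex of one side and any vertex of the other
there is exactly one arc, and there are no arcs within a side. -/
def IsCompleteBipOrientation (s t : ℕ) (A : Fin s ⊕ Fin t → Fin s ⊕ Fin t → Prop) : Prop :=
  (∀ (x : Fin s) (y : Fin t),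
      (A (.inl x) (.inr y) ∨ A (.inr y) (.inl x)) ∧
        ¬(A (.inl x) (.inr y) ∧ A (.inr y) (.inl x))) ∧
  (∀ x x' : Fin s, ¬ A (.inl x) (.inl x')) ∧
  (∀ y y' : Fin t, ¬ A (.inr y) (.inr y'))

theorem bip_geodetic (r : ℕ) (A : Fin r ⊕ Fin r → Fin r ⊕ Fin r → Prop)
    (h1 : ∀ i j, A (.inl i) (.inr j) ↔ i = j) (h2 : ∀ i j, A (.inr j) (.inl i) ↔ i ≠ j)
    (h3 : ∀ i j, ¬ A (.inl i) (.inl j)) (h4 : ∀ i j, ¬ A (.inr i) (.inr j)) :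
    IsKGeodetic A 2 := by
  have key : ∀ p : List (Fin r ⊕ Fin r), IsWalk A p → p.length ≤ 3 →
      (∃ a, p = [a]) ∨ (∃ i, p = [.inl i, .inr i]) ∨ (∃ i j, i ≠ j ∧ p = [.inr j, .inl i]) ∨
      (∃ i j, i ≠ j ∧ p = [.inl i, .inr i, .inl j]) ∨
      (∃ i j, i ≠ j ∧ p = [.inr j, .inl i, .inr i]) := by
    rintro p ⟨hne, hc⟩ hl
    replace hc : p.IsChain A := hc
    match p, hne, hc, hl with
    | [a], _, _, _ => exact Or.inl ⟨a, rfl⟩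
    | [a, b], _, hc, _ =>
      simp only [List.isChain_cons_cons] at hc
      rcases a with a | a <;> rcases b with b | b <;> simp_all
    | [a, b, c], _, hc, _ =>
      simp only [List.isChain_cons_cons] at hc
      rcases a with a | a <;> rcases b with b | b <;> rcases c with c | c <;> simp_all
      · exact fun h => hc.2 h.symm
      · exact fun h => hc.1 (hc.2.trans h)
    | a :: b :: c :: d :: l, _, _, hl => simp at hl; omega
  intro p q hp hq hh hg hlp hlq
  rcases key p hp hlp with ⟨a, rfl⟩ | ⟨i, rfl⟩ | ⟨i, j, hij, rfl⟩ | ⟨i, j, hij, rfl⟩ | ⟨i, j, hij, rfl⟩ <;>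
  rcases key q hq hlq with ⟨a', rfl⟩ | ⟨i', rfl⟩ | ⟨i', j', hij', rfl⟩ | ⟨i', j', hij', rfl⟩ | ⟨i', j', hij', rfl⟩ <;>
  simp at hh hg ⊢ <;> grind

theorem bip_strong (r : ℕ) (hr : 2 ≤ r) (A : Fin r ⊕ Fin r → Fin r ⊕ Fin r → Prop)
    (h1 : ∀ i j, A (.inl i) (.inr j) ↔ i = j) (h2 : ∀ i j, A (.inr j) (.inl i) ↔ i ≠ j)
    (u v : Fin r ⊕ Fin r) : Relation.ReflTransGen A u v := by
  have a1 : ∀ i, Relation.ReflTransGen A (.inl i) (.inr i) :=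
    fun i => .single ((h1 i i).2 rfl)
  have a2 : ∀ i j, i ≠ j → Relation.ReflTransGen A (.inr j) (.inl i) :=
    fun i j h => .single ((h2 i j).2 h)
  have a3 : ∀ i j, Relation.ReflTransGen A (.inr j) (.inl i) := by
    intro i j
    by_cases h : i = j
    · subst h
      haveI : Nontrivial (Fin r) := Fin.nontrivial_iff_two_le.2 hr
      obtain ⟨k, hk⟩ := exists_ne i
      exact (a2 k i hk).trans ((a1 k).trans (a2 i k hk.symm))
    · exact a2 i j h
  rcases u with i | i <;> rcases v with j | j
  · exact (a1 i).trans (a3 j i)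
  · exact (a1 i).trans ((a3 j i).trans (a1 j))
  · exact a3 j i
  · exact (a3 j i).trans (a1 j)

theorem bip_arcs (r : ℕ) (A : Fin r ⊕ Fin r → Fin r ⊕ Fin r → Prop)
    (h1 : ∀ i j, A (.inl i) (.inr j) ↔ i = j) (h2 : ∀ i j, A (.inr j) (.inl i) ↔ i ≠ j)
    (h3 : ∀ i j, ¬ A (.inl i) (.inl j)) (h4 : ∀ i j, ¬ A (.inr i) (.inr j)) :
    numArcs A = r ^ 2 := by
  let f : Fin r × Fin r → {p : (Fin r ⊕ Fin r) × (Fin r ⊕ Fin r) // A p.1 p.2} := fun x =>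
    if h : x.1 = x.2 then ⟨(.inl x.1, .inr x.2), (h1 _ _).2 h⟩
    else ⟨(.inr x.2, .inl x.1), (h2 _ _).2 h⟩
  have hf : Function.Bijective f := by
    constructor
    · rintro ⟨a, b⟩ ⟨c, d⟩ h
      simp only [f] at h
      split_ifs at h <;> simp_all
    · rintro ⟨⟨a | a, b | b⟩, h⟩
      · exact absurd h (h3 _ _)
      · exact ⟨(a, b), by simp only [f]; rw [dif_pos ((h1 _ _).1 h)]⟩
      · exact ⟨(b, a), by simp only [f]; rw [dif_neg ((h2 _ _).1 h)]⟩
      · exact absurd h (h4 _ _)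
  rw [numArcs, ← Nat.card_eq_of_bijective f hf]
  simp [sq]

/-- For `n = 2r`, `r ≥ 2`, the orientation of `K_{r,r}` with a perfect matching directed
from `X` to `Y` and all other edges from `Y` to `X` is a strongly connected 2-geodetic
digraph with `r²` arcs. -/
theorem stmt9 (r : ℕ) (hr : 2 ≤ r) :
    IsKGeodetic (fun p q : Fin r ⊕ Fin r =>
      match p, q with
      | .inl i, .inr j => i = j
      | .inr j, .inl i => i ≠ j
      | _, _ => False) 2 ∧
    (∀ u v : Fin r ⊕ Fin r, Relation.ReflTransGen (fun p q : Fin r ⊕ Fin r =>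
      match p, q with
      | .inl i, .inr j => i = j
      | .inr j, .inl i => i ≠ j
      | _, _ => False) u v) ∧
    numArcs (fun p q : Fin r ⊕ Fin r =>
      match p, q with
      | .inl i, .inr j => i = j
      | .inr j, .inl i => i ≠ j
      | _, _ => False) = r ^ 2 := by
  refine ⟨bip_geodetic r _ ?_ ?_ ?_ ?_, bip_strong r hr _ ?_ ?_, bip_arcs r _ ?_ ?_ ?_ ?_⟩ <;>
    intro i j <;> simp
end

section
/- For all r ≥ 1, every 2-geodetic digraph on n = 2r+1 vertices with more than r²+2 arcs contains a source or a sink. In particular, the maximum number of arcs in a strongly connected 2-geodetic digraph on 2r+1 vertices is r²+2. -/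
section Helpers
open Finset

theorem geo_forward {V : Type*} {A : V → V → Prop} (h : IsKGeodetic A 2) :
    (∀ u, ¬ A u u) ∧ (∀ u v, A u v → ¬ A v u) ∧
    (∀ u v w, A u v → A v w → ¬ A u w) ∧
    (∀ u a b v, A u a → A a v → A u b → A b v → a = b) := by
  refine ⟨?_, ?_, ?_, ?_⟩
  · intro u hu
    have := h [u] [u, u] (by simp [IsWalk, List.Chain']) (by simp [IsWalk, List.Chain', hu]) (by simp) (by simp) (by simp) (by simp)
    simp at this
  · intro u v h1 h2
    have := h [u] [u, v, u] (by simp [IsWalk, List.Chain']) (by simp [IsWalk, List.Chain', h1, h2]) (by simp) (by simp) (by simp) (by simp)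
    simp at this
  · intro u v w h1 h2 h3
    have := h [u, w] [u, v, w] (by simp [IsWalk, List.Chain', h3]) (by simp [IsWalk, List.Chain', h1, h2]) (by simp) (by simp) (by simp) (by simp)
    simp at this
  · intro u a b v h1 h2 h3 h4
    have := h [u, a, v] [u, b, v] (by simp [IsWalk, List.Chain', h1, h2]) (by simp [IsWalk, List.Chain', h3, h4]) (by simp) (by simp) (by simp) (by simp)
    simpa using this

theorem geo_backward {V : Type*} {A : V → V → Prop}
    (h1 : ∀ u, ¬ A u u) (h2 : ∀ u v, A u v → ¬ A v u)
    (h3 : ∀ u v w, A u v → A v w → ¬ A u w)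
    (h4 : ∀ u a b v, A u a → A a v → A u b → A b v → a = b) : IsKGeodetic A 2 := by
  intro p q hp hq hh hl lp lq
  rcases p with _ | ⟨p0, _ | ⟨p1, _ | ⟨p2, _ | ⟨p3, p⟩⟩⟩⟩ <;>
  rcases q with _ | ⟨q0, _ | ⟨q1, _ | ⟨q2, _ | ⟨q3, q⟩⟩⟩⟩ <;>
  simp [IsWalk, List.Chain'] at hp hq hh hl lp lq ⊢ <;> grind

open Classical in
/-- degree inside a set -/
noncomputable def dg {V : Type*} (G : V → V → Prop) (W : Finset V) (u : V) : ℕ :=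
  (W.filter (fun v => G u v)).card

theorem exists_big_edge {V : Type*} (G : V → V → Prop) (hs : ∀ u v, G u v → G v u)
    (W : Finset V) (hpos : 0 < ∑ u ∈ W, dg G W u) :
    ∃ u ∈ W, ∃ v ∈ W, G u v ∧ 2 * (∑ x ∈ W, dg G W x) ≤ W.card * (dg G W u + dg G W v) := by
  classical
  by_contra hcon
  push Not at hcon
  set E := ∑ x ∈ W, dg G W x with hE
  have key : ∑ u ∈ W, ∑ v ∈ W.filter (fun v => G u v), W.card * (dg G W u + dg G W v)
      < ∑ u ∈ W, ∑ v ∈ W.filter (fun v => G u v), 2 * E := by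
    have hle : ∀ u ∈ W, ∑ v ∈ W.filter (fun v => G u v), W.card * (dg G W u + dg G W v)
        ≤ ∑ v ∈ W.filter (fun v => G u v), 2 * E := by
      intro u hu
      apply Finset.sum_le_sum
      intro v hv
      simp only [mem_filter] at hv
      exact (hcon u hu v hv.1 hv.2).le
    obtain ⟨u, hu, hud⟩ := Finset.exists_ne_zero_of_sum_ne_zero hpos.ne'
    refine Finset.sum_lt_sum hle ⟨u, hu, ?_⟩
    apply Finset.sum_lt_sum_of_nonempty
    · rw [← Finset.card_pos]; exact Nat.pos_of_ne_zero hud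
    · intro v hv
      simp only [mem_filter] at hv
      exact hcon u hu v hv.1 hv.2
  have h1 : ∑ u ∈ W, ∑ v ∈ W.filter (fun v => G u v), 2 * E = 2 * E * E := by
    simp only [sum_const, smul_eq_mul]
    rw [← Finset.sum_mul]
    change E * (2 * E) = _
    ring
  have h2 : ∑ u ∈ W, ∑ v ∈ W.filter (fun v => G u v), dg G W u = ∑ u ∈ W, dg G W u ^ 2 := by
    apply Finset.sum_congr rfl
    intro u _
    simp only [sum_const, smul_eq_mul]
    change dg G W u * _ = _
    ring
  have h3 : ∑ u ∈ W, ∑ v ∈ W.filter (fun v => G u v), dg G W v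
      = ∑ u ∈ W, ∑ v ∈ W.filter (fun v => G u v), dg G W u := by
    simp only [Finset.sum_filter]
    rw [Finset.sum_comm]
    apply Finset.sum_congr rfl
    intro u _
    apply Finset.sum_congr rfl
    intro v _
    have : G u v ↔ G v u := ⟨hs u v, hs v u⟩
    simp [this]
  have h4 : ∑ u ∈ W, ∑ v ∈ W.filter (fun v => G u v), W.card * (dg G W u + dg G W v)
      = W.card * (2 * ∑ u ∈ W, dg G W u ^ 2) := by
    simp only [← Finset.mul_sum, Finset.sum_add_distrib]
    rw [h3, h2]; ring
  have h5 := sq_sum_le_card_mul_sum_sq (s := W) (f := dg G W)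
  rw [h4, h1] at key
  rw [← hE] at h5
  nlinarith

theorem sum_dg_even {V : Type*} (A G : V → V → Prop) (hG : ∀ u v, G u v ↔ A u v ∨ A v u)
    (hA : ∀ u v, A u v → ¬ A v u) (W : Finset V) :
    ∑ u ∈ W, dg G W u = 2 * ∑ u ∈ W, dg A W u := by
  classical
  have h1 : ∀ u, dg G W u = dg A W u + dg (fun a b => A b a) W u := by
    intro u
    unfold dg
    rw [← Finset.card_union_of_disjoint]
    · congr 1; ext v; simp [hG]; tauto
    · rw [Finset.disjoint_filter]; intro v _; exact hA u v
  have h2 : ∑ u ∈ W, dg (fun a b => A b a) W u = ∑ u ∈ W, dg A W u := by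
    unfold dg
    simp only [Finset.card_filter]
    rw [Finset.sum_comm]
  simp only [h1, Finset.sum_add_distrib, h2]; ring

theorem dg_disj {V : Type*} [DecidableEq V] (G : V → V → Prop) (W W' : Finset V) (h : Disjoint W W') (u : V) :
    dg G (W ∪ W') u = dg G W u + dg G W' u := by
  classical
  unfold dg
  rw [Finset.filter_union, Finset.card_union_of_disjoint]
  exact Finset.disjoint_filter_filter h

theorem sum_dg_comm {V : Type*} (G : V → V → Prop) (hs : ∀ u v, G u v → G v u)
    (X Y : Finset V) : ∑ x ∈ X, dg G Y x = ∑ y ∈ Y, dg G X y := by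
  classical
  unfold dg
  simp only [Finset.card_filter]
  rw [Finset.sum_comm]
  apply Finset.sum_congr rfl
  intro u _
  apply Finset.sum_congr rfl
  intro v _
  have : G u v ↔ G v u := ⟨hs u v, hs v u⟩
  simp [this]

theorem triangle_removal {V : Type*} [DecidableEq V] (G : V → V → Prop) (hs : ∀ u v, G u v → G v u)
    (hirr : ∀ u, ¬ G u u)
    (ht : ∀ u v w x, G u v → G u w → G v w → G u x → G v x → w = x)
    (W : Finset V) (a b c : V) (ha : a ∈ W) (hb : b ∈ W) (hc : c ∈ W)
    (hab : G a b) (hac : G a c) (hbc : G b c) :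
    (W \ {a, b, c}).card + 3 = W.card ∧
    ∑ u ∈ W, dg G W u ≤ ∑ u ∈ W \ {a, b, c}, dg G (W \ {a, b, c}) u + 2 * W.card := by
  classical
  have nab : a ≠ b := by rintro rfl; exact hirr _ hab
  have nac : a ≠ c := by rintro rfl; exact hirr _ hac
  have nbc : b ≠ c := by rintro rfl; exact hirr _ hbc
  have hT : ({a, b, c} : Finset V).card = 3 := by
    rw [Finset.card_eq_three]; exact ⟨a, b, c, nab, nac, nbc, rfl⟩
  have hsub : ({a, b, c} : Finset V) ⊆ W := by
    intro x; simp; rintro (rfl | rfl | rfl) <;> assumption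
  have hcard : (W \ {a, b, c}).card + 3 = W.card := by
    rw [← hT]; exact Finset.card_sdiff_add_card_eq_card hsub
  refine ⟨hcard, ?_⟩
  set T : Finset V := {a, b, c} with hTd
  set W' := W \ T with hW'
  have hdis : Disjoint W' T := Finset.sdiff_disjoint
  have hun : W' ∪ T = W := Finset.sdiff_union_of_subset hsub
  have e1 : ∑ u ∈ W, dg G W u = ∑ u ∈ W', dg G W' u + ∑ u ∈ W', dg G T u
      + (∑ u ∈ T, dg G W' u + ∑ u ∈ T, dg G T u) := by
    rw [← hun, Finset.sum_union hdis]
    simp only [dg_disj G W' T hdis, Finset.sum_add_distrib]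
  have e2 : ∑ u ∈ W', dg G T u ≤ W'.card := by
    rw [Finset.card_eq_sum_ones]
    apply Finset.sum_le_sum
    intro x hx
    have hx' : x ≠ a ∧ x ≠ b ∧ x ≠ c := by
      simp [hW', hTd] at hx; tauto
    unfold dg
    rw [Finset.card_le_one]
    intro y hy z hz
    simp only [hTd, mem_filter, mem_insert, mem_singleton] at hy hz
    have sab := hs _ _ hab
    have sac := hs _ _ hac
    have sbc := hs _ _ hbc
    obtain ⟨hy1, hy2⟩ := hy
    obtain ⟨hz1, hz2⟩ := hz
    have sy := hs _ _ hy2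
    have sz := hs _ _ hz2
    obtain ⟨n1, n2, n3⟩ := hx'
    rcases hy1 with rfl | rfl | rfl <;> rcases hz1 with rfl | rfl | rfl <;> first
      | rfl
      | (exfalso; first
          | exact n1 (ht _ _ _ _ (by assumption) sy sz (by assumption) (by assumption))
          | exact n2 (ht _ _ _ _ (by assumption) sy sz (by assumption) (by assumption))
          | exact n3 (ht _ _ _ _ (by assumption) sy sz (by assumption) (by assumption)))
  have e3 : ∑ u ∈ T, dg G W' u = ∑ u ∈ W', dg G T u := sum_dg_comm G hs _ _
  have e4 : ∑ u ∈ T, dg G T u ≤ 6 := by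
    have : ∀ u ∈ T, dg G T u ≤ 2 := by
      intro u hu
      have : dg G T u ≤ (T.erase u).card := by
        apply Finset.card_le_card
        intro y hy
        simp only [mem_filter] at hy
        rw [Finset.mem_erase]
        refine ⟨?_, hy.1⟩
        rintro rfl; exact hirr _ hy.2
      rw [Finset.card_erase_of_mem hu, hT] at this
      exact this
    have := Finset.sum_le_card_nsmul T _ 2 this
    rw [hT] at this; simpa using this
  omega

theorem dg_le_erase {V : Type*} (G : V → V → Prop) (hirr : ∀ u, ¬ G u u) (W : Finset V) (u : V)
    (hu : u ∈ W) : dg G W u + 1 ≤ W.card := by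
  classical
  have : dg G W u ≤ (W.erase u).card := by
    apply Finset.card_le_card
    intro y hy
    simp only [mem_filter] at hy
    rw [Finset.mem_erase]
    refine ⟨?_, hy.1⟩
    rintro rfl; exact hirr _ hy.2
  rw [Finset.card_erase_of_mem hu] at this
  have := Finset.card_pos.2 ⟨u, hu⟩
  omega

theorem edge_sum_le {V : Type*} (G : V → V → Prop) 
    (W : Finset V) (u v : V) (h : ∀ w ∈ W, G u w → G v w → False) :
    dg G W u + dg G W v ≤ W.card := by
  classical
  unfold dg
  rw [← Finset.card_union_of_disjoint]
  · apply Finset.card_le_card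
    intro x; simp; tauto
  · rw [Finset.disjoint_filter]; exact h

theorem mantel_like {V : Type*} (G : V → V → Prop) (hs : ∀ u v, G u v → G v u)
    (hirr : ∀ u, ¬ G u u)
    (ht : ∀ u v w x, G u v → G u w → G v w → G u x → G v x → w = x) :
    ∀ (n : ℕ) (W : Finset V), W.card = n → 2 * ∑ u ∈ W, dg G W u ≤ n ^ 2 + 3 := by
  classical
  intro n
  induction n using Nat.strong_induction_on with
  | _ n ih =>
  intro W hW
  by_cases hpos : 0 < ∑ u ∈ W, dg G W u
  swap
  · have : ∑ u ∈ W, dg G W u = 0 := by omega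
    rw [this]; omega
  by_cases htri : ∃ a ∈ W, ∃ b ∈ W, ∃ c ∈ W, G a b ∧ G a c ∧ G b c
  · obtain ⟨a, ha, b, hb, c, hc, hab, hac, hbc⟩ := htri
    obtain ⟨h1, h2⟩ := triangle_removal G hs hirr ht W a b c ha hb hc hab hac hbc
    set W' := W \ {a, b, c}
    have h3 := ih W'.card (by omega) W' rfl
    by_cases h5 : 5 ≤ n
    · have : W'.card + 3 = n := by omega
      nlinarith
    · have h6 : ∑ u ∈ W', dg G W' u ≤ ∑ u ∈ W', 0 := by
        apply Finset.sum_le_sum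
        intro u hu
        have := dg_le_erase G hirr W' u hu
        omega
      simp only [sum_const_zero] at h6
      have : n = 3 ∨ n = 4 := by omega
      rcases this with h | h <;> subst h <;> omega
  · obtain ⟨u, hu, v, hv, huv, hle⟩ := exists_big_edge G hs W hpos
    have := edge_sum_le G W u v (fun w hw h1 h2 => htri ⟨u, hu, v, hv, w, hw, huv, h1, h2⟩)
    rw [hW] at this hle
    nlinarith


theorem out_card_le {V : Type*} [Fintype V] [DecidableEq V] (A : V → V → Prop)
    (h2 : ∀ u v, A u v → ¬ A v u)
    (h4 : ∀ u a b v, A u a → A a v → A u b → A b v → a = b)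
    (hout : ∀ v, ∃ w, A v w)
    (X : Finset V) (hX : ∀ u v, A u v → (u ∈ X ↔ v ∉ X)) (x : V) (hx : x ∈ X) :
    dg A Xᶜ x + 1 ≤ X.card := by
  classical
  choose f hf using hout
  have : dg A Xᶜ x ≤ (X.erase x).card := by
    apply Finset.card_le_card_of_injOn f
    · intro s hs
      simp only [coe_filter, mem_compl, Set.mem_ofPred_eq] at hs
      have h5 := hX _ _ (hf s)
      simp only [coe_erase, Set.mem_sdiff, mem_coe, Set.mem_singleton_iff]
      refine ⟨by tauto, ?_⟩
      intro h6
      have := hf s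
      rw [h6] at this
      exact h2 _ _ this hs.2
    · intro s hs s' hs' hss
      simp only [coe_filter, mem_compl, Set.mem_ofPred_eq] at hs hs'
      have h6 := hf s
      rw [hss] at h6
      exact h4 x s s' (f s') hs.2 h6 hs'.2 (hf s')
  rw [Finset.card_erase_of_mem hx] at this
  have := Finset.card_pos.2 ⟨x, hx⟩
  omega

theorem full_unique {V : Type*} [Fintype V] [DecidableEq V] (A : V → V → Prop)
    (h2 : ∀ u v, A u v → ¬ A v u)
    (h4 : ∀ u a b v, A u a → A a v → A u b → A b v → a = b)
    (hout : ∀ v, ∃ w, A v w) (hin : ∀ v, ∃ w, A w v)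
    (X : Finset V) (hX : ∀ u v, A u v → (u ∈ X ↔ v ∉ X)) (hXc : X.card + 1 ≤ Xᶜ.card)
    (x0 x1 : V) (hx0 : x0 ∈ X)
    (hf0 : ∀ y ∈ Xᶜ, A x0 y ∨ A y x0) (hf1 : ∀ y ∈ Xᶜ, A x1 y ∨ A y x1) : x0 = x1 := by
  classical
  by_contra hne
  have c1 := out_card_le A h2 h4 hout X hX x0 hx0
  have c2 := out_card_le (fun a b => A b a) (fun u v h => h2 v u h)
    (fun u a b v p1 p2 p3 p4 => h4 v a b u p2 p1 p4 p3) hin X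
    (fun u v h => by have := hX v u h; tauto) x0 hx0
  have c3 : Xᶜ.card ≤ dg A Xᶜ x0 + dg (fun a b => A b a) Xᶜ x0 := by
    unfold dg
    refine le_trans (Finset.card_le_card ?_) (Finset.card_union_le _ _)
    intro y hy
    have := hf0 y hy
    simp only [mem_union, mem_filter]
    tauto
  have c4 : 1 < dg A Xᶜ x0 := by omega
  have c5 : 1 < dg (fun a b => A b a) Xᶜ x0 := by omega
  unfold dg at c4 c5
  rw [Finset.one_lt_card] at c4 c5
  obtain ⟨s, hs, s', hs', hss⟩ := c4
  obtain ⟨t, ht, t', ht', htt⟩ := c5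
  simp only [mem_filter] at hs hs' ht ht'
  rcases hf1 s hs.1 with q | q
  · have k : ∀ y ∈ Xᶜ, A y x0 → A x1 y := by
      intro y hy hyx
      rcases hf1 y hy with z | z
      · exact z
      · exact absurd (h4 y x0 x1 s hyx hs.2 z q) hne
    exact htt (h4 x1 t t' x0 (k t ht.1 ht.2) ht.2 (k t' ht'.1 ht'.2) ht'.2)
  · rcases hf1 s' hs'.1 with q' | q'
    · have k : ∀ y ∈ Xᶜ, A y x0 → A x1 y := by
        intro y hy hyx
        rcases hf1 y hy with z | z
        · exact z
        · exact absurd (h4 y x0 x1 s' hyx hs'.2 z q') hne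
      exact htt (h4 x1 t t' x0 (k t ht.1 ht.2) ht.2 (k t' ht'.1 ht'.2) ht'.2)
    · exact hss (h4 x0 s s' x1 hs.2 q hs'.2 q')

theorem bip_bound {V : Type*} [Fintype V] [DecidableEq V] (A G : V → V → Prop)
    (hG : ∀ u v, G u v ↔ A u v ∨ A v u)
    (h2 : ∀ u v, A u v → ¬ A v u)
    (h4 : ∀ u a b v, A u a → A a v → A u b → A b v → a = b)
    (hout : ∀ v, ∃ w, A v w) (hin : ∀ v, ∃ w, A w v)
    (X : Finset V) (hX : ∀ u v, G u v → (u ∈ X ↔ v ∉ X)) (hXc : X.card + 1 ≤ Xᶜ.card) :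
    ∑ u, dg G univ u + 2 * X.card ≤ 2 * (X.card * Xᶜ.card + 1) := by
  classical
  have hs : ∀ u v, G u v → G v u := by intro u v; rw [hG, hG]; tauto
  have e1 : ∑ u ∈ X, dg G univ u = ∑ u ∈ X, dg G Xᶜ u := by
    apply Finset.sum_congr rfl
    intro u hu
    unfold dg
    congr 1
    ext v
    have := hX u v
    simp only [mem_filter, mem_univ, mem_compl, true_and]
    tauto
  have e2 : ∑ u ∈ Xᶜ, dg G univ u = ∑ u ∈ Xᶜ, dg G X u := by
    apply Finset.sum_congr rfl
    intro u hu
    rw [mem_compl] at hu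
    unfold dg
    congr 1
    ext v
    have := hX u v
    simp only [mem_filter, mem_univ, true_and]
    tauto
  have e3 := sum_dg_comm G hs Xᶜ X
  have e4 : ∑ u, dg G univ u = 2 * ∑ u ∈ X, dg G Xᶜ u := by
    rw [← Finset.sum_add_sum_compl X, e1, e2, e3]; ring
  have e5 : ∀ x ∈ X, dg G Xᶜ x + 1 ≤ Xᶜ.card + if (∀ y ∈ Xᶜ, G x y) then 1 else 0 := by
    intro x hx
    split_ifs with h
    · have : dg G Xᶜ x ≤ Xᶜ.card := Finset.card_filter_le _ _
      omega
    · have : dg G Xᶜ x < Xᶜ.card := by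
        apply Finset.card_lt_card
        rw [Finset.filter_ssubset]
        push Not at h
        exact h
      omega
  have e6 := Finset.sum_le_sum e5
  rw [Finset.sum_add_distrib, Finset.sum_add_distrib, ← Finset.card_filter] at e6
  have e7 : (X.filter (fun x => ∀ y ∈ Xᶜ, G x y)).card ≤ 1 := by
    rw [Finset.card_le_one]
    intro a ha b hb
    simp only [mem_filter] at ha hb
    exact full_unique A h2 h4 hout hin X (fun u v h => hX u v ((hG u v).2 (Or.inl h))) hXc a b ha.1
      (fun y hy => (hG _ _).1 (ha.2 y hy)) (fun y hy => (hG _ _).1 (hb.2 y hy))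
  simp only [sum_const, smul_eq_mul, mul_one] at e6
  omega

theorem col2 {V : Type*} (G : V → V → Prop) (P Q : Finset V)
    (jP : ∀ x y, x ∈ P → y ∈ P → ¬ G x y) (jQ : ∀ x y, x ∈ Q → y ∈ Q → ¬ G x y)
    (jPQ : ∀ x, x ∈ P → x ∉ Q) (jo : ∀ x, x ∈ P ∨ x ∈ Q) (x y : V) (hxy : G x y) :
    x ∈ P ↔ y ∉ P := by
  constructor
  · intro h h'
    exact jP x y h h' hxy
  · intro h
    rcases jo x with h1 | h1
    · exact h1
    · rcases jo y with h2 | h2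
      · exact absurd h2 h
      · exact absurd hxy (jQ x y h1 h2)

theorem col3 {V : Type*} [DecidableEq V] (G : V → V → Prop) (hs : ∀ u v, G u v → G v u)
    (hirr : ∀ u, ¬ G u u) (P Q : Finset V) (z : V)
    (jP : ∀ x y, x ∈ P → y ∈ P → ¬ G x y) (jQ : ∀ x y, x ∈ Q → y ∈ Q → ¬ G x y)
    (jPQ : ∀ x, x ∈ P → x ∉ Q) (hz : z ∉ Q) (jo : ∀ x, x ∈ P ∨ x ∈ Q ∨ x = z)
    (ca : ∀ x ∈ P, ¬ G z x) :
    ∃ X : Finset V, ∀ u v, G u v → (u ∈ X ↔ v ∉ X) := by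
  refine ⟨insert z P, col2 G (insert z P) Q ?_ jQ ?_ ?_⟩
  · intro x y hx hy hxy
    rw [mem_insert] at hx hy
    rcases hx with rfl | hx
    · rcases hy with rfl | hy
      · exact hirr _ hxy
      · exact ca y hy hxy
    · rcases hy with rfl | hy
      · exact ca x hx (hs _ _ hxy)
      · exact jP x y hx hy hxy
  · intro x hx
    rw [mem_insert] at hx
    rcases hx with rfl | hx
    · exact hz
    · exact jPQ x hx
  · intro x
    rw [mem_insert]
    rcases jo x with h | h | h
    · exact Or.inl (Or.inr h)
    · exact Or.inr h
    · exact Or.inl (Or.inl h)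

theorem exists_coloring {V : Type*} [Fintype V] [DecidableEq V] (G : V → V → Prop)
    (hs : ∀ u v, G u v → G v u) (hirr : ∀ u, ¬ G u u)
    (htf : ∀ a b c, G a b → G a c → G b c → False) (r : ℕ) (hV : Fintype.card V = 2 * r + 1)
    (hm : 2 * (r ^ 2 + 2) ≤ ∑ u, dg G univ u) :
    ∃ X : Finset V, ∀ u v, G u v → (u ∈ X ↔ v ∉ X) := by
  classical
  obtain ⟨u, -, v, -, huv, hle⟩ := exists_big_edge G hs univ (by omega)
  rw [Finset.card_univ, hV] at hle
  have hd : 2 * r ≤ dg G univ u + dg G univ v := by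
    by_contra hlt
    have : dg G univ u + dg G univ v + 1 ≤ 2 * r := by omega
    nlinarith
  set P := univ.filter (fun x => G u x) with hP
  set Q := univ.filter (fun x => G v x) with hQ
  have mP : ∀ x, x ∈ P ↔ G u x := by simp [hP]
  have mQ : ∀ x, x ∈ Q ↔ G v x := by simp [hQ]
  have hPQ : Disjoint P Q := by
    rw [Finset.disjoint_left]
    intro x hx hy
    exact htf u v x huv ((mP x).1 hx) ((mQ x).1 hy)
  have hdu : dg G univ u = P.card := rfl
  have hdv : dg G univ v = Q.card := rfl
  have iP : ∀ x y, x ∈ P → y ∈ P → ¬ G x y := fun x y hx hy h =>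
    htf u x y ((mP x).1 hx) ((mP y).1 hy) h
  have iQ : ∀ x y, x ∈ Q → y ∈ Q → ¬ G x y := fun x y hx hy h =>
    htf v x y ((mQ x).1 hx) ((mQ y).1 hy) h
  have dPQ : ∀ x, x ∈ P → x ∉ Q := fun x hx hy => Finset.disjoint_left.1 hPQ hx hy
  have hcl : (P ∪ Q)ᶜ.card ≤ 1 := by
    rw [Finset.card_compl, Finset.card_union_of_disjoint hPQ, hV]; omega
  by_cases hz : ∃ z, z ∉ P ∧ z ∉ Q
  swap
  · push Not at hz
    exact ⟨P, col2 G P Q iP iQ dPQ (fun x => or_iff_not_imp_left.2 (hz x))⟩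
  obtain ⟨z, hzP, hzQ⟩ := hz
  have honly : ∀ x, x ∈ P ∨ x ∈ Q ∨ x = z := by
    intro x
    by_contra hcon
    push Not at hcon
    rw [Finset.card_le_one] at hcl
    exact hcon.2.2 (hcl x (by simp [hcon.1, hcon.2.1]) z (by simp [hzP, hzQ]))
  by_cases ca : ∀ x ∈ P, ¬ G z x
  · exact col3 G hs hirr P Q z iP iQ dPQ hzQ honly ca
  by_cases cb : ∀ x ∈ Q, ¬ G z x
  · exact col3 G hs hirr Q P z iQ iP (fun x h h1 => dPQ x h1 h) hzP (fun x => or_left_comm.1 (honly x)) cb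
  exfalso
  push Not at ca cb
  set a := dg G P z with ha
  set b := dg G Q z with hb
  have ha1 : 1 ≤ a := by
    obtain ⟨x, hx, hzx⟩ := ca
    exact Finset.card_pos.2 ⟨x, by simp [hx, hzx]⟩
  have hb1 : 1 ≤ b := by
    obtain ⟨x, hx, hzx⟩ := cb
    exact Finset.card_pos.2 ⟨x, by simp [hx, hzx]⟩
  have hdz : Disjoint (P ∪ Q) {z} := by simp [hzP, hzQ]
  have huniv : (univ : Finset V) = (P ∪ Q) ∪ {z} := by
    ext x
    simp only [mem_univ, mem_union, mem_singleton, true_iff]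
    exact or_assoc.2 (honly x)
  have hdeg : ∀ x, dg G univ x = dg G P x + dg G Q x + dg G {z} x := by
    intro x
    rw [huniv, dg_disj G _ _ hdz, dg_disj G _ _ hPQ]
  have zero : ∀ (W : Finset V) x, (∀ y ∈ W, ¬ G x y) → dg G W x = 0 := by
    intro W x h
    unfold dg
    rw [Finset.card_eq_zero, Finset.filter_eq_empty_iff]
    exact h
  have hzz : dg G {z} z = 0 := zero _ _ (by simpa using hirr z)
  have sP : ∑ x ∈ P, dg G {z} x = a := by
    rw [sum_dg_comm G hs, sum_singleton]
  have sQ : ∑ x ∈ Q, dg G {z} x = b := by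
    rw [sum_dg_comm G hs, sum_singleton]
  have sPP : ∑ x ∈ P, dg G P x = 0 := Finset.sum_eq_zero (fun x hx => zero _ _ (fun y hy => iP x y hx hy))
  have sQQ : ∑ x ∈ Q, dg G Q x = 0 := Finset.sum_eq_zero (fun x hx => zero _ _ (fun y hy => iQ x y hx hy))
  have sQP : ∑ x ∈ Q, dg G P x = ∑ x ∈ P, dg G Q x := sum_dg_comm G hs _ _
  have sPQ : ∑ x ∈ P, dg G Q x + a * b ≤ P.card * Q.card := by
    have : ∀ x ∈ P, dg G Q x + (if G z x then b else 0) ≤ Q.card := by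
      intro x hx
      split_ifs with h
      · exact edge_sum_le G Q x z (fun w _ h1 h2 => htf z x w h h2 h1)
      · exact Finset.card_filter_le _ _
    have := Finset.sum_le_sum this
    rw [Finset.sum_add_distrib, ← Finset.sum_filter] at this
    simp only [sum_const, smul_eq_mul] at this
    exact this
  have htot : ∑ x, dg G univ x = 2 * ∑ x ∈ P, dg G Q x + 2 * (a + b) := by
    conv_lhs => rw [huniv]
    rw [Finset.sum_union hdz, Finset.sum_union hPQ, sum_singleton, ← huniv]
    simp only [hdeg, Finset.sum_add_distrib, sP, sQ, sPP, sQQ, sQP, hzz, ← ha, ← hb]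
    ring
  have hcard : P.card + Q.card + 1 = 2 * r + 1 := by
    rw [← hV, ← Finset.card_univ, huniv, Finset.card_union_of_disjoint hdz,
      Finset.card_union_of_disjoint hPQ, Finset.card_singleton]
  have hab : a + b ≤ a * b + 1 := by nlinarith
  have hpq : P.card * Q.card ≤ r ^ 2 := by
    have : P.card + Q.card = 2 * r := by omega
    have h' : (P.card : ℤ) + Q.card = 2 * r := by exact_mod_cast this
    have : (P.card : ℤ) * Q.card ≤ r ^ 2 := by nlinarith [sq_nonneg ((P.card : ℤ) - Q.card)]
    exact_mod_cast this
  omega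

theorem numArcs_eq {V : Type*} [Fintype V] (A : V → V → Prop) :
    numArcs A = ∑ u, dg A univ u := by
  classical
  unfold numArcs dg
  rw [Nat.card_eq_fintype_card, Fintype.card_subtype]
  simp only [Finset.card_filter]
  rw [Fintype.sum_prod_type]

theorem upper {V : Type*} [Fintype V] [DecidableEq V] (A : V → V → Prop) (r : ℕ)
    (hV : Fintype.card V = 2 * r + 1) (hr : 1 ≤ r) (hgeo : IsKGeodetic A 2)
    (hout : ∀ v, ∃ w, A v w) (hin : ∀ v, ∃ w, A w v) : numArcs A ≤ r ^ 2 + 2 := by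
  classical
  obtain ⟨h1, h2, h3, h4⟩ := geo_forward hgeo
  set G : V → V → Prop := fun u v => A u v ∨ A v u with hGd
  have hG : ∀ u v, G u v ↔ A u v ∨ A v u := fun u v => Iff.rfl
  have hs : ∀ u v, G u v → G v u := by intro u v; rw [hG, hG]; tauto
  have hirr : ∀ u, ¬ G u u := by intro u; rw [hG]; have := h1 u; tauto
  have ev := sum_dg_even A G hG h2
  rw [numArcs_eq]
  have ev1 := ev univ
  by_contra hcon
  push Not at hcon
  by_cases htri : ∃ a b c, G a b ∧ G a c ∧ G b c
  · obtain ⟨a, b, c, hab, hac, hbc⟩ := htri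
    have ht : ∀ u v w x, G u v → G u w → G v w → G u x → G v x → w = x := by
      have aux : ∀ u v w, A u v → G u w → G v w → A v w ∧ A w u := by
        intro u v w p q s
        have := h3 u v w; have := h3 u w v; have := h3 w u v
        rw [hG] at q s
        tauto
      intro u v w x p q s q' s'
      rcases p with p | p
      · have t1 := aux u v w p q s
        have t2 := aux u v x p q' s'
        exact h4 v w x u t1.1 t1.2 t2.1 t2.2
      · have t1 := aux v u w p s q
        have t2 := aux v u x p s' q'
        exact h4 u w x v t1.1 t1.2 t2.1 t2.2
    obtain ⟨k1, k2⟩ := triangle_removal G hs hirr ht univ a b c (mem_univ _) (mem_univ _) (mem_univ _) hab hac hbc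
    have k3 := mantel_like G hs hirr ht _ (univ \ {a, b, c}) rfl
    have ev2 := ev (univ \ {a, b, c})
    rw [Finset.card_univ, hV] at k1 k2
    obtain ⟨s, rfl⟩ : ∃ s, r = s + 1 := ⟨r - 1, by omega⟩
    have k4 : (univ \ {a, b, c} : Finset V).card = 2 * s := by omega
    rw [k4] at k3
    have : (s + 1) ^ 2 = s ^ 2 + 2 * s + 1 := by ring
    have : (2 * s) ^ 2 = 4 * s ^ 2 := by ring
    omega
  · have htf : ∀ a b c, G a b → G a c → G b c → False := fun a b c p q s => htri ⟨a, b, c, p, q, s⟩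
    obtain ⟨X, hX⟩ := exists_coloring G hs hirr htf r hV (by omega)
    have hc := Finset.card_add_card_compl X
    rw [hV] at hc
    have main : ∃ p q, p + q = 2 * r + 1 ∧ ∑ u, dg G univ u + 2 * p ≤ 2 * (p * q + 1) := by
      by_cases hle : X.card + 1 ≤ Xᶜ.card
      · exact ⟨_, _, hc, bip_bound A G hG h2 h4 hout hin X hX hle⟩
      · refine ⟨Xᶜ.card, Xᶜᶜ.card, by rw [compl_compl]; omega, bip_bound A G hG h2 h4 hout hin Xᶜ ?_ ?_⟩
        · intro u v h
          have := hX u v h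
          simp only [mem_compl]; tauto
        · rw [compl_compl]; omega
    obtain ⟨p, q, hpq, hb⟩ := main
    rw [ev1] at hb
    have h' : (p : ℤ) + q = 2 * r + 1 := by exact_mod_cast hpq
    have hb' : (2 * ∑ u, dg A univ u : ℤ) + 2 * p ≤ 2 * (p * q + 1) := by exact_mod_cast hb
    have hc' : (r : ℤ) ^ 2 + 2 < ∑ u, dg A univ u := by exact_mod_cast hcon
    have : (q : ℤ) = 2 * r + 1 - p := by linarith
    rw [this] at hb'
    nlinarith [sq_nonneg ((p : ℤ) - r)]

/-- The extremal digraph. -/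
def exA (r : ℕ) (u v : Fin (2 * r + 1)) : Prop :=
  (u.1 < r ∧ r ≤ v.1 ∧ v.1 < 2 * r ∧ v.1 ≠ u.1 + r) ∨
  (r ≤ u.1 ∧ u.1 < 2 * r ∧ v.1 + r = u.1) ∨
  (u.1 = 0 ∧ v.1 = 2 * r) ∨ (u.1 = 2 * r ∧ v.1 = r)

theorem exA_mk {r i j : ℕ} {hi : i < 2 * r + 1} {hj : j < 2 * r + 1}
    (h : (i < r ∧ r ≤ j ∧ j < 2 * r ∧ j ≠ i + r) ∨ (r ≤ i ∧ i < 2 * r ∧ j + r = i) ∨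
      (i = 0 ∧ j = 2 * r) ∨ (i = 2 * r ∧ j = r)) : exA r ⟨i, hi⟩ ⟨j, hj⟩ := h

theorem exA_geo (r : ℕ) (hr : 1 ≤ r) : IsKGeodetic (exA r) 2 := by
  apply geo_backward
  · intro u; unfold exA; omega
  · intro u v; unfold exA; omega
  · intro u v w; unfold exA; omega
  · intro u a b v h1 h2 h3 h4
    apply Fin.ext
    unfold exA at *
    omega

theorem exA_conn (r : ℕ) (hr : 1 ≤ r) (u v : Fin (2 * r + 1)) :
    Relation.ReflTransGen (exA r) u v := by
  have st : ∀ (i j : ℕ) (hi : i < 2 * r + 1) (hj : j < 2 * r + 1),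
      exA r ⟨i, hi⟩ ⟨j, hj⟩ → Relation.ReflTransGen (exA r) ⟨i, hi⟩ ⟨j, hj⟩ :=
    fun i j hi hj h => Relation.ReflTransGen.single h
  have y0 : Relation.ReflTransGen (exA r) ⟨r, by omega⟩ ⟨0, by omega⟩ :=
    st _ _ _ _ (exA_mk (by omega))
  have xi : ∀ i (hi : i < 2 * r + 1), i < r → Relation.ReflTransGen (exA r) ⟨i, hi⟩ ⟨0, by omega⟩ := by
    intro i hi hir
    by_cases h0 : i = 0
    · subst h0; exact Relation.ReflTransGen.refl
    · exact (st i r _ (by omega) (exA_mk (by omega))).trans y0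
  have toHub : ∀ i (hi : i < 2 * r + 1), Relation.ReflTransGen (exA r) ⟨i, hi⟩ ⟨0, by omega⟩ := by
    intro i hi
    rcases lt_or_ge i r with h | h
    · exact xi i hi h
    rcases lt_or_ge i (2 * r) with h' | h'
    · exact (st i (i - r) _ (by omega) (exA_mk (by omega))).trans (xi (i - r) _ (by omega))
    · exact (st i r _ (by omega) (exA_mk (by omega))).trans y0
  have yj : ∀ j (hj : j < 2 * r + 1), r ≤ j → Relation.ReflTransGen (exA r) ⟨0, by omega⟩ ⟨j, hj⟩ := by
    intro j hj hrj
    by_cases h0 : j = r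
    · subst h0
      exact (st 0 (2 * j) _ (by omega) (exA_mk (by omega))).trans
        (st (2 * j) j _ _ (exA_mk (by omega)))
    · exact st 0 j _ _ (exA_mk (by omega))
  have fromHub : ∀ j (hj : j < 2 * r + 1), Relation.ReflTransGen (exA r) ⟨0, by omega⟩ ⟨j, hj⟩ := by
    intro j hj
    rcases lt_or_ge j r with h | h
    · exact (yj (j + r) (by omega) (by omega)).trans (st (j + r) j _ _ (exA_mk (by omega)))
    · exact yj j hj h
  exact (toHub u.1 u.2).trans (fromHub v.1 v.2)

theorem exA_card (r : ℕ) (hr : 1 ≤ r) : numArcs (exA r) = r ^ 2 + 2 := by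
  let f : (Fin r × Fin r) ⊕ Bool → {p : Fin (2 * r + 1) × Fin (2 * r + 1) // exA r p.1 p.2} := fun s =>
    match s with
    | .inl (i, j) =>
      if h : i.1 = j.1 then
        ⟨(⟨i.1 + r, by omega⟩, ⟨i.1, by omega⟩), exA_mk (by omega)⟩
      else
        ⟨(⟨i.1, by omega⟩, ⟨j.1 + r, by omega⟩), exA_mk (by omega)⟩
    | .inr true => ⟨(⟨0, by omega⟩, ⟨2 * r, by omega⟩), exA_mk (by omega)⟩
    | .inr false => ⟨(⟨2 * r, by omega⟩, ⟨r, by omega⟩), exA_mk (by omega)⟩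
  have hf : Function.Bijective f := by
    constructor
    · rintro (⟨⟨i, hi⟩, ⟨j, hj⟩⟩ | b) (⟨⟨i', hi'⟩, ⟨j', hj'⟩⟩ | b') h
      · by_cases h1 : i = j <;> by_cases h2 : i' = j' <;> simp [f, h1, h2] at h ⊢ <;> omega
      · by_cases h1 : i = j <;> cases b' <;> simp [f, h1] at h ⊢ <;> omega
      · by_cases h1 : i' = j' <;> cases b <;> simp [f, h1] at h ⊢ <;> omega
      · cases b <;> cases b' <;> simp [f] at h ⊢ <;> omega
    · rintro ⟨⟨⟨u, hu⟩, ⟨v, hv⟩⟩, h⟩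
      have h0 := h
      unfold exA at h
      simp only at h
      rcases h with h | h | h | h
      · refine ⟨.inl (⟨u, by omega⟩, ⟨v - r, by omega⟩), ?_⟩
        have : ¬ (u = v - r) := by omega
        apply Subtype.ext; apply Prod.ext <;> apply Fin.ext <;> simp [f, this] <;> omega
      · refine ⟨.inl (⟨v, by omega⟩, ⟨v, by omega⟩), ?_⟩
        apply Subtype.ext; apply Prod.ext <;> apply Fin.ext <;> simp [f] <;> omega
      · refine ⟨.inr true, ?_⟩
        apply Subtype.ext; apply Prod.ext <;> apply Fin.ext <;> simp [f] <;> omega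
      · refine ⟨.inr false, ?_⟩
        apply Subtype.ext; apply Prod.ext <;> apply Fin.ext <;> simp [f] <;> omega
  unfold numArcs
  rw [← Nat.card_congr (Equiv.ofBijective f hf)]
  simp [sq]

end Helpers

/-- For `r ≥ 1`, every 2-geodetic digraph on `2r+1` vertices with more than `r² + 2`
arcs contains a source or a sink; consequently the maximum number of arcs of a
strongly connected 2-geodetic digraph on `2r+1` vertices is exactly `r² + 2`. -/
theorem stmt10 (r : ℕ) (hr : 1 ≤ r) :
    (∀ A : Fin (2 * r + 1) → Fin (2 * r + 1) → Prop, IsKGeodetic A 2 →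
      r ^ 2 + 2 < numArcs A → ∃ v, inDeg A v = 0 ∨ outDeg A v = 0) ∧
    IsGreatest {m | ∃ A : Fin (2 * r + 1) → Fin (2 * r + 1) → Prop,
      (∀ u v, Relation.ReflTransGen A u v) ∧ IsKGeodetic A 2 ∧ numArcs A = m}
      (r ^ 2 + 2) := by
  have key : ∀ A : Fin (2 * r + 1) → Fin (2 * r + 1) → Prop, IsKGeodetic A 2 →
      r ^ 2 + 2 < numArcs A → ∃ v, inDeg A v = 0 ∨ outDeg A v = 0 := by
    intro A hA hm
    by_contra hcon
    push Not at hcon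
    have hout : ∀ v, ∃ w, A v w := by
      intro v
      obtain ⟨⟨w, hw⟩⟩ := (Nat.card_pos_iff.1 (Nat.pos_of_ne_zero (hcon v).2)).1
      exact ⟨w, hw⟩
    have hin : ∀ v, ∃ w, A w v := by
      intro v
      obtain ⟨⟨w, hw⟩⟩ := (Nat.card_pos_iff.1 (Nat.pos_of_ne_zero (hcon v).1)).1
      exact ⟨w, hw⟩
    have := upper A r (by simp) hr hA hout hin
    omega
  refine ⟨key, ⟨exA r, exA_conn r hr, exA_geo r hr, exA_card r hr⟩, ?_⟩
  rintro m ⟨A, hconn, hgeo, rfl⟩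
  have hne : ∀ v : Fin (2 * r + 1), ∃ w, w ≠ v := by
    intro v
    have : Nontrivial (Fin (2 * r + 1)) := Fin.nontrivial_iff_two_le.2 (by omega)
    exact exists_ne v
  apply upper A r (by simp) hr hgeo
  · intro v
    obtain ⟨w, hw⟩ := hne v
    rcases Relation.ReflTransGen.cases_head (hconn v w) with h | ⟨c, hc, -⟩
    · exact absurd h.symm hw
    · exact ⟨c, hc⟩
  · intro v
    obtain ⟨w, hw⟩ := hne v
    rcases Relation.ReflTransGen.cases_tail (hconn w v) with h | ⟨c, -, hc⟩
    · exact absurd h.symm hw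
    · exact ⟨c, hc⟩
end

section
/- The number of directed triangles (directed 3-cycles) in a 2-geodetic digraph on n vertices is at most ⌊(n/6)(√(4n−3) − 1)⌋. -/
theorem geo_h00 {V : Type*} {A : V → V → Prop} (h : IsKGeodetic A 2) (u : V) : ¬ A u u := by
  intro h1
  have := h [u] [u, u] (by simp [IsWalk, List.Chain']) (by simp [IsWalk, List.Chain', h1]) (by simp) (by simp) (by simp)
    (by simp)
  simp at this

theorem geo_h02 {V : Type*} {A : V → V → Prop} (h : IsKGeodetic A 2) {u w : V}
    (h1 : A u w) (h2 : A w u) : False := by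
  have := h [u] [u, w, u] (by simp [IsWalk, List.Chain']) (by simp [IsWalk, List.Chain', h1, h2]) (by simp) (by simp)
    (by simp) (by simp)
  simp at this

theorem geo_h12 {V : Type*} {A : V → V → Prop} (h : IsKGeodetic A 2) {u v w : V}
    (h0 : A u v) (h1 : A u w) (h2 : A w v) : False := by
  have := h [u, v] [u, w, v] (by simp [IsWalk, List.Chain', h0]) (by simp [IsWalk, List.Chain', h1, h2]) (by simp)
    (by simp) (by simp) (by simp)
  simp at this

theorem geo_h22 {V : Type*} {A : V → V → Prop} (h : IsKGeodetic A 2) {u v w x : V}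
    (h1 : A u w) (h2 : A w v) (h3 : A u x) (h4 : A x v) : w = x := by
  have := h [u, w, v] [u, x, v] (by simp [IsWalk, List.Chain', h1, h2]) (by simp [IsWalk, List.Chain', h3, h4]) (by simp)
    (by simp) (by simp) (by simp)
  simpa using this

/-- Parametrised directed triangles. -/
abbrev Tri {V : Type*} (A : V → V → Prop) : Type _ :=
  {c : ZMod 3 → V // Function.Injective c ∧ ∀ i, A (c i) (c (i + 1))}

theorem Tri.a01 {V : Type*} {A : V → V → Prop} (c : Tri A) : A (c.1 0) (c.1 1) := c.2.2 0
theorem Tri.a12 {V : Type*} {A : V → V → Prop} (c : Tri A) : A (c.1 1) (c.1 2) := c.2.2 1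
theorem Tri.a20 {V : Type*} {A : V → V → Prop} (c : Tri A) : A (c.1 2) (c.1 0) := c.2.2 2

theorem Tri.ext3 {V : Type*} {A : V → V → Prop} {c d : Tri A} (h0 : c.1 0 = d.1 0)
    (h1 : c.1 1 = d.1 1) (h2 : c.1 2 = d.1 2) : c = d := by
  apply Subtype.ext
  funext i
  have : i = 0 ∨ i = 1 ∨ i = 2 := by revert i; decide
  rcases this with rfl | rfl | rfl <;> assumption

/-- Rotation of a triangle. -/
def Tri.rot {V : Type*} {A : V → V → Prop} (c : Tri A) : Tri A :=
  ⟨fun i => c.1 (i + 1), fun _ _ h => add_right_cancel (c.2.1 h), fun i => c.2.2 (i + 1)⟩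

theorem Tri.rot3 {V : Type*} {A : V → V → Prop} (c : Tri A) : c.rot.rot.rot = c := by
  apply Tri.ext3 <;> rfl

theorem Tri.three_dvd {V : Type*} [Fintype V] (A : V → V → Prop) : 3 ∣ Nat.card (Tri A) := by
  classical
  have hne : ¬ (1 : ZMod 3) = 0 := by decide
  let e : Function.End (Tri A) := Tri.rot
  have : Fact (Nat.Prime 3) := ⟨by norm_num⟩
  have hp : e ^ 3 ^ 1 = 1 := by
    funext c
    exact c.rot3
  have h := Equiv.Perm.card_fixedPoints_modEq hp
  have h0 : Fintype.card (Function.fixedPoints e) = 0 := by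
    rw [Fintype.card_eq_zero_iff]
    refine ⟨fun ⟨c, hc⟩ => ?_⟩
    have h1 : c.rot = c := hc
    have h2 : c.1 1 = c.1 0 := congrArg (fun d : Tri A => d.1 0) h1
    exact hne (c.2.1 h2)
  rw [h0] at h
  rw [Nat.card_eq_fintype_card]
  exact (Nat.modEq_zero_iff_dvd).1 h

/-- Endpoints of walks of length at most two. -/
def triMap {V : Type*} (A : V → V → Prop) :
    V ⊕ Tri A ⊕ (Σ v : V, {c : Tri A // c.1 0 = v} × {c : Tri A // c.1 0 = v}) → V × V
  | .inl v => (v, v)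
  | .inr (.inl c) => (c.1 0, c.1 1)
  | .inr (.inr ⟨_, c, d⟩) => (c.1.1 2, d.1.1 1)

theorem triMap_inj {V : Type*} {A : V → V → Prop} (h : IsKGeodetic A 2) :
    Function.Injective (triMap A) := by
  have key : ∀ c d : Tri A, c.1 0 = d.1 0 → c.1 1 = d.1 1 → c = d := fun c d h0 h1 =>
    Tri.ext3 h0 h1 (geo_h22 h c.a12 c.a20 (h1 ▸ d.a12) (h0 ▸ d.a20))
  have key2 : ∀ c d : Tri A, c.1 0 = d.1 0 → c.1 2 = d.1 2 → c = d := fun c d h0 h2 =>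
    Tri.ext3 h0 (geo_h22 h c.a01 c.a12 (h0 ▸ d.a01) (h2 ▸ d.a12)) h2
  rintro (u | c | ⟨v, ⟨c, hc⟩, ⟨d, hd⟩⟩) (u' | c' | ⟨v', ⟨c', hc'⟩, ⟨d', hd'⟩⟩) he <;>
    simp only [triMap, Prod.mk.injEq] at he <;> obtain ⟨e1, e2⟩ := he
  · rw [e1]
  · exact (geo_h00 h _ (by have := c'.a01; rwa [← e1, ← e2] at this)).elim
  · have h1 := c'.a20
    have h2 := d'.a01
    rw [hc', ← e1] at h1
    rw [hd', ← e2] at h2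
    exact (geo_h02 h h1 h2).elim
  · exact (geo_h00 h _ (by have := c.a01; rwa [e1, e2] at this)).elim
  · rw [key c c' e1 e2]
  · have h1 := c'.a20
    have h2 := d'.a01
    rw [hc', ← e1] at h1
    rw [hd', ← e2] at h2
    exact (geo_h12 h c.a01 h1 h2).elim
  · have h1 := c.a20
    have h2 := d.a01
    rw [hc, e1] at h1
    rw [hd, e2] at h2
    exact (geo_h02 h h1 h2).elim
  · have h1 := c.a20
    have h2 := d.a01
    rw [hc, e1] at h1
    rw [hd, e2] at h2
    exact (geo_h12 h c'.a01 h1 h2).elim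
  · have h1 := c.a20
    have h2 := d.a01
    have h3 := c'.a20
    have h4 := d'.a01
    rw [hc, e1] at h1
    rw [hd, e2] at h2
    rw [hc'] at h3
    rw [hd'] at h4
    obtain rfl : v = v' := geo_h22 h h1 h2 h3 h4
    obtain rfl := key2 c c' (hc.trans hc'.symm) e1
    obtain rfl := key d d' (hd.trans hd'.symm) e2
    rfl

theorem tri_card_bound {V : Type*} [Fintype V] {A : V → V → Prop} (h : IsKGeodetic A 2) :
    (Fintype.card V) ^ 2 + Fintype.card V * Nat.card (Tri A) + (Nat.card (Tri A)) ^ 2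
      ≤ (Fintype.card V) ^ 3 := by
  classical
  have h1 := Fintype.card_le_of_injective _ (triMap_inj h)
  simp only [Fintype.card_sum, Fintype.card_sigma, Fintype.card_prod] at h1
  have h2 : Fintype.card (Tri A) = ∑ v : V, Fintype.card {c : Tri A // c.1 0 = v} := by
    rw [← Fintype.card_sigma]
    exact (Fintype.card_congr (Equiv.sigmaFiberEquiv (fun c : Tri A => c.1 0))).symm
  have h3 := sq_sum_le_card_mul_sum_sq (s := (Finset.univ : Finset V))
    (f := fun v => Fintype.card {c : Tri A // c.1 0 = v})
  rw [← h2, Finset.card_univ] at h3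
  simp only [← pow_two] at h1
  rw [Nat.card_eq_fintype_card]
  have h4 := Nat.mul_le_mul_left (Fintype.card V) h1
  nlinarith

/-- The number of directed triangles in a 2-geodetic digraph on `n` vertices is at most
`⌊(n/6)(√(4n-3) - 1)⌋`. (Each triangle, counted up to rotation, corresponds to exactly
`3` cyclic parametrisations `c : ZMod 3 → V`.) -/
theorem stmt17 {V : Type*} [Fintype V] (A : V → V → Prop) (hgeo : IsKGeodetic A 2) :
    Nat.card {c : ZMod 3 → V // Function.Injective c ∧ ∀ i, A (c i) (c (i + 1))} ≤
      3 * ⌊(Fintype.card V : ℝ) / 6 *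
        (Real.sqrt (4 * (Fintype.card V : ℝ) - 3) - 1)⌋₊ := by
  obtain ⟨T, hT⟩ := Tri.three_dvd A
  have hb := tri_card_bound hgeo
  change Nat.card (Tri A) ≤ _
  rw [hT] at hb ⊢
  refine Nat.mul_le_mul_left 3 (Nat.le_floor ?_)
  generalize Fintype.card V = n at hb
  have hb' : (n : ℝ) ^ 2 + n * (3 * T) + (3 * T) ^ 2 ≤ (n : ℝ) ^ 3 := by exact_mod_cast hb
  rcases Nat.eq_zero_or_pos n with rfl | hn
  · have : T = 0 := by
      by_contra hne
      have := Nat.pos_of_ne_zero hne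
      nlinarith
    simp [this]
  · have hn' : (0 : ℝ) < n := by exact_mod_cast hn
    have hT0 : (0 : ℝ) ≤ T := Nat.cast_nonneg T
    have hs : 6 * (T : ℝ) / n + 1 ≤ Real.sqrt (4 * n - 3) := by
      apply Real.le_sqrt_of_sq_le
      have : (6 * (T : ℝ) / n + 1) ^ 2 = (6 * T + n) ^ 2 / n ^ 2 := by field_simp
      rw [this, div_le_iff₀ (by positivity)]
      nlinarith
    have h5 : 6 * (T : ℝ) / n ≤ Real.sqrt (4 * n - 3) - 1 := by linarith
    rw [div_le_iff₀ hn'] at h5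
    linarith
end
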